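/- (Furstenberg's Correspondence Principle) Let Λ ⊂ ℕ. Then there exist a measure preserving system (X, 𝒳, μ, T) with T invertible and a set A ∈ 𝒳 such that μ(A) = d̄(Λ) and, for every r ∈ ℕ and all integers n₁, …, n_r, d̄(Λ ∩ (Λ + n₁) ∩ ⋯ ∩ (Λ + n_r)) ≥ μ(A ∩ T^{-n₁}A ∩ ⋯ ∩ T^{-n_r}A). -/

import Mathlib

open MeasureTheory Filter Finset

open Classical in
/-- The upper density `d̄(Λ) = limsup_{N→∞} |Λ ∩ [1,N]| / N`. -/
noncomputable def upperDensity (Λ : Set ℕ) : ℝ :=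
  Filter.limsup (fun N : ℕ => (((Finset.Icc 1 N).filter (fun m => m ∈ Λ)).card : ℝ) / N)
    Filter.atTop

/-- The shift `Λ + m = {x + m : x ∈ Λ}`, viewed inside `ℕ`. -/
def shiftSet (Λ : Set ℕ) (m : ℤ) : Set ℕ := {x : ℕ | ∃ y ∈ Λ, (x : ℤ) = (y : ℤ) + m}

open Topology BoundedContinuousFunction

open Classical in
/-- The proportion of elements of `[1, N]` lying in `Λ`. -/
noncomputable def densityUpTo (Λ : Set ℕ) (N : ℕ) : ℝ :=
  (((Finset.Icc 1 N).filter (fun m => m ∈ Λ)).card : ℝ) / N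

lemma densityUpTo_nonneg (Λ : Set ℕ) (N : ℕ) : 0 ≤ densityUpTo Λ N := by
  unfold densityUpTo; positivity

lemma densityUpTo_le_one (Λ : Set ℕ) (N : ℕ) : densityUpTo Λ N ≤ 1 := by
  classical
  unfold densityUpTo
  refine div_le_one_of_le₀ ?_ (by positivity)
  exact_mod_cast (Finset.card_filter_le (Finset.Icc 1 N) _).trans_eq (by simp)

lemma upperDensity_eq_limsup_succ (Λ : Set ℕ) :
    upperDensity Λ = limsup (fun N => densityUpTo Λ (N + 1)) atTop :=
  (limsup_nat_add (densityUpTo Λ) 1).symm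

lemma exists_ultrafilter_tendsto_upperDensity (Λ : Set ℕ) :
    ∃ U : Ultrafilter ℕ, (U : Filter ℕ) ≤ atTop ∧
      Tendsto (fun N => densityUpTo Λ (N + 1)) U (𝓝 (upperDensity Λ)) := by
  rw [upperDensity_eq_limsup_succ, ← mapClusterPt_iff_ultrafilter]
  exact MapClusterPt.limsup
    (isBoundedUnder_of ⟨0, fun N => densityUpTo_nonneg Λ _⟩).isCoboundedUnder_flip
    (isBoundedUnder_of ⟨1, fun N => densityUpTo_le_one Λ _⟩)

lemma le_upperDensity_of_tendsto {Λ : Set ℕ} {U : Ultrafilter ℕ} {c : ℝ}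
    (hU : (U : Filter ℕ) ≤ atTop)
    (hc : Tendsto (fun N => densityUpTo Λ (N + 1)) U (𝓝 c)) : c ≤ upperDensity Λ := by
  rw [upperDensity_eq_limsup_succ]
  exact (mapClusterPt_iff_ultrafilter.2 ⟨U, hU, hc⟩).le_limsup
    (isBoundedUnder_of ⟨1, fun N => densityUpTo_le_one Λ _⟩)

section Empirical

variable {X : Type*} [MeasurableSpace X]

/-- The empirical measure of the points `x 1, …, x (N + 1)`. -/
noncomputable def empiricalMeasure (x : ℕ → X) (N : ℕ) : ProbabilityMeasure X :=
  ⟨((N + 1 : ℕ) : ENNReal)⁻¹ • ∑ m ∈ Finset.Icc 1 (N + 1), Measure.dirac (x m), ⟨by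
    simp only [Measure.smul_apply, Measure.finsetSum_apply, measure_univ, smul_eq_mul]
    simpa using ENNReal.inv_mul_cancel (a := ((N + 1 : ℕ) : ENNReal)) (by simp)
      (ENNReal.natCast_ne_top _)⟩⟩

lemma empiricalMeasure_apply (x : ℕ → X) (N : ℕ) {E : Set X} (hE : MeasurableSet E) :
    ((empiricalMeasure x N : Measure X) E).toReal = densityUpTo (x ⁻¹' E) (N + 1) := by
  classical
  simp only [empiricalMeasure, densityUpTo, ProbabilityMeasure.coe_mk, Measure.smul_apply,
    Measure.finsetSum_apply, Measure.dirac_apply' _ hE, smul_eq_mul, ENNReal.toReal_mul,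
    ENNReal.toReal_inv, ENNReal.toReal_natCast, Set.mem_preimage, Set.indicator_apply,
    Pi.one_apply, Finset.sum_boole]
  rw [div_eq_inv_mul]

variable [TopologicalSpace X]

lemma integral_empiricalMeasure [OpensMeasurableSpace X] (x : ℕ → X) (N : ℕ) (f : X →ᵇ ℝ) :
    ∫ y, f y ∂(empiricalMeasure x N : Measure X) =
      (∑ m ∈ Finset.range (N + 1), f (x (m + 1))) / ((N + 1 : ℕ) : ℝ) := by
  simp only [empiricalMeasure, ProbabilityMeasure.coe_mk]
  rw [integral_smul_measure, integral_finsetSum_measure fun m _ => f.integrable _]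
  simp only [integral_dirac' _ _ f.continuous.measurable.stronglyMeasurable]
  rw [ENNReal.toReal_inv, ENNReal.toReal_natCast, smul_eq_mul, div_eq_inv_mul,
    Finset.range_eq_Ico, Finset.sum_Ico_add' (fun m => f (x m))]
  rfl

lemma map_eq_of_tendsto_empiricalMeasure [BorelSpace X] [HasOuterApproxClosed X]
    {x : ℕ → X} {T : X → X} (hT : Continuous T) (hx : ∀ m, T (x (m + 1)) = x m)
    {L : Filter ℕ} [L.NeBot] (hL : L ≤ atTop) {μ : ProbabilityMeasure X}
    (hμ : Tendsto (empiricalMeasure x) L (𝓝 μ)) :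
    (μ : Measure X).map T = μ := by
  have : IsProbabilityMeasure ((μ : Measure X).map T) :=
    Measure.isProbabilityMeasure_map hT.measurable.aemeasurable
  refine ext_of_forall_integral_eq_of_IsFiniteMeasure fun f => ?_
  rw [integral_map hT.measurable.aemeasurable f.continuous.measurable.aestronglyMeasurable]
  rw [ProbabilityMeasure.tendsto_iff_forall_integral_tendsto] at hμ
  have h := (hμ (f.compContinuous ⟨T, hT⟩)).sub (hμ f)
  have hzero : Tendsto (fun N : ℕ => (f (x 0) - f (x (N + 1))) / ((N + 1 : ℕ) : ℝ)) L (𝓝 0) := by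
    refine Tendsto.mono_left ?_ hL
    refine squeeze_zero_norm (a := fun N : ℕ => 2 * ‖f‖ / ((N + 1 : ℕ) : ℝ)) (fun N => ?_) ?_
    · rw [norm_div, Real.norm_natCast]
      gcongr
      rw [two_mul]
      exact (norm_sub_le _ _).trans
        (add_le_add (f.norm_coe_le_norm _) (f.norm_coe_le_norm _))
    · exact (tendsto_const_div_atTop_nhds_zero_nat (2 * ‖f‖)).comp (tendsto_add_atTop_nat 1)
  refine sub_eq_zero.1 (tendsto_nhds_unique h (hzero.congr fun N => ?_))
  rw [integral_empiricalMeasure, integral_empiricalMeasure, ← sub_div, ← Finset.sum_sub_distrib]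
  simp only [compContinuous_apply, ContinuousMap.coe_mk, hx]
  rw [Finset.sum_range_sub' (fun m => f (x m))]

lemma tendsto_densityUpTo_of_isClopen [BorelSpace X] [HasOuterApproxClosed X]
    {x : ℕ → X} {L : Filter ℕ} {μ : ProbabilityMeasure X}
    (hμ : Tendsto (empiricalMeasure x) L (𝓝 μ)) {E : Set X} (hE : IsClopen E) :
    Tendsto (fun N => densityUpTo (x ⁻¹' E) (N + 1)) L (𝓝 ((μ : Measure X) E).toReal) := by
  simp only [← empiricalMeasure_apply x _ hE.isOpen.measurableSet]
  exact (ENNReal.tendsto_toReal (measure_ne_top _ _)).comp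
    (ProbabilityMeasure.tendsto_measure_of_null_frontier_of_tendsto' hμ (by simp [hE.frontier_eq]))

end Empirical

/-- The shift `(T x) k = x (k - 1)` on bi-infinite binary sequences. -/
def binaryShift : Equiv.Perm (ℤ → Bool) where
  toFun x k := x (k - 1)
  invFun x k := x (k + 1)
  left_inv x := by simp
  right_inv x := by simp

lemma binaryShift_zpow_apply (n : ℤ) (x : ℤ → Bool) (k : ℤ) :
    (binaryShift ^ n) x k = x (k - n) := by
  induction n generalizing x with
  | zero => simp
  | succ i ih =>
    rw [zpow_add_one, Equiv.Perm.mul_apply, ih]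
    exact congrArg x (by ring)
  | pred i ih =>
    rw [zpow_sub_one, Equiv.Perm.mul_apply, ih]
    exact congrArg x (by ring)

lemma continuous_binaryShift_zpow (n : ℤ) : Continuous ⇑(binaryShift ^ n) :=
  continuous_pi fun k => by
    simp only [binaryShift_zpow_apply]
    exact continuous_apply _

open Classical in
/-- The indicator sequence of `Λ` translated to the left by `m`. -/
noncomputable def indicatorTranslate (Λ : Set ℕ) (m : ℕ) : ℤ → Bool :=
  fun k => decide (∃ y ∈ Λ, (y : ℤ) = k + m)

lemma binaryShift_indicatorTranslate_succ (Λ : Set ℕ) (m : ℕ) :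
    binaryShift (indicatorTranslate Λ (m + 1)) = indicatorTranslate Λ m := by
  funext k
  simp [binaryShift, indicatorTranslate]

lemma isClopen_setOf_apply_eq_true (k : ℤ) : IsClopen {x : ℤ → Bool | x k = true} :=
  (isClopen_discrete {true}).preimage (continuous_apply k)

lemma indicatorTranslate_preimage (Λ : Set ℕ) :
    indicatorTranslate Λ ⁻¹' {x | x 0 = true} = Λ := by
  ext m
  simp [indicatorTranslate]

lemma indicatorTranslate_preimage_zpow (Λ : Set ℕ) (n : ℤ) :
    indicatorTranslate Λ ⁻¹' (⇑(binaryShift ^ n) ⁻¹' {x | x 0 = true}) = shiftSet Λ n := by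
  ext m
  simp only [indicatorTranslate, Set.mem_preimage, Set.mem_ofPred_eq, binaryShift_zpow_apply,
    decide_eq_true_eq, shiftSet]
  refine exists_congr fun y => and_congr_right fun _ => ?_
  omega

theorem furstenberg_correspondence_principle (Λ : Set ℕ) :
    ∃ (X : Type) (_ : MeasurableSpace X) (μ : Measure X) (T : Equiv.Perm X),
      IsProbabilityMeasure μ ∧
      MeasurePreserving T μ μ ∧ MeasurePreserving T.symm μ μ ∧
      ∃ A : Set X, MeasurableSet A ∧ (μ A).toReal = upperDensity Λ ∧
        ∀ r : ℕ, ∀ n : Fin r → ℤ,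
          (μ (A ∩ ⋂ i, ⇑(T ^ n i) ⁻¹' A)).toReal ≤
            upperDensity (Λ ∩ ⋂ i, shiftSet Λ (n i)) := by
  obtain ⟨U, hU, hlim⟩ := exists_ultrafilter_tendsto_upperDensity Λ
  obtain ⟨μ, hμ⟩ : ∃ μ, Tendsto (empiricalMeasure (indicatorTranslate Λ)) U (𝓝 μ) :=
    ⟨_, (U.map (empiricalMeasure (indicatorTranslate Λ))).le_nhds_lim⟩
  have hT : Measurable binaryShift := by
    simpa using (continuous_binaryShift_zpow 1).measurable
  have hTsymm : Measurable binaryShift.symm := by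
    simpa using (continuous_binaryShift_zpow (-1)).measurable
  have hmap : (μ : Measure (ℤ → Bool)).map binaryShift = μ :=
    map_eq_of_tendsto_empiricalMeasure (by simpa using continuous_binaryShift_zpow 1)
      (binaryShift_indicatorTranslate_succ Λ) hU hμ
  have hA := isClopen_setOf_apply_eq_true 0
  refine ⟨ℤ → Bool, inferInstance, μ, binaryShift, inferInstance, ⟨hT, hmap⟩, ⟨hTsymm, ?_⟩,
    {x | x 0 = true}, hA.isOpen.measurableSet, ?_, fun r n => ?_⟩
  · conv_lhs => rw [← hmap]
    rw [Measure.map_map hTsymm hT]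
    simp
  · have h := tendsto_densityUpTo_of_isClopen hμ hA
    rw [indicatorTranslate_preimage] at h
    exact tendsto_nhds_unique h hlim
  · refine le_upperDensity_of_tendsto hU ?_
    have h := tendsto_densityUpTo_of_isClopen hμ (hA.inter (isClopen_iInter_of_finite fun i =>
      hA.preimage (continuous_binaryShift_zpow (n i))))
    simpa only [Set.preimage_inter, Set.preimage_iInter, indicatorTranslate_preimage,
      indicatorTranslate_preimage_zpow] using h
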